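/- arXiv:2210.02256 — 2 statements merged into one kernel-verified Lean document; each statement's English description precedes it below -/
import Mathlib

section
/- Let (Ω, ℱ, P) be a probability space with a filtration (ℱ_i)_{i ≥ 0}, and let (ξ_i)_{i ≥ 1} be a square-integrable martingale difference sequence adapted to (ℱ_i) (each ξ_i is ℱ_i-measurable with E[ξ_i | ℱ_{i−1}] = 0). Define S_n := Σ_{i=1}^{n} ξ_i and ⟨S⟩_n := Σ_{i=1}^{n} E[ξ_i² | ℱ_{i−1}]. Suppose ξ_i ≤ B almost surely for all i ≥ 1, where B > 0 is a constant. Then for all δ ∈ (0, 1/3), with probability at least 1 − 3δ it holds that for every k ≥ 1: S_k ≤ 2·√(⟨S⟩_k · ε(δ,k)) + 4B·ε(δ,k), where ε(δ,k) := log(1/δ) + 2·log(1 + log₂⁺(⟨S⟩_k / B²)). -/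
section Auxiliary

open MeasureTheory Finset

/-- A one-sided quadratic bound for the exponential below a level `u < 1`. -/
theorem Real.exp_le_one_add_add_sq_div {y u : ℝ} (hu0 : 0 ≤ u) (hu1 : u < 1) (hy : y ≤ u) :
    Real.exp y ≤ 1 + y + y ^ 2 / (2 * (1 - u)) := by
  have hu : 0 < 1 - u := by linarith
  rcases le_or_gt y 0 with h | h
  · have hexp : Real.exp y ≤ 1 + y + y ^ 2 / 2 := by
      have h1 := Real.quadratic_le_exp_of_nonneg (x := -y) (by linarith)
      have h2 : Real.exp y * Real.exp (-y) = 1 := by rw [← Real.exp_add]; simp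
      have h3 := Real.exp_pos y
      have h4 : 0 < 1 + y + y ^ 2 / 2 := by nlinarith [sq_nonneg (y + 1)]
      nlinarith [mul_le_mul_of_nonneg_left h1 h4.le, sq_nonneg (y ^ 2),
        mul_le_mul_of_nonneg_left h1 h3.le, sq_nonneg y]
    refine hexp.trans ?_
    gcongr
    linarith
  · have h1 := Real.exp_bound' h.le (by linarith) (n := 3) (by norm_num)
    norm_num [Finset.sum_range_succ, Nat.factorial] at h1
    refine h1.trans ?_
    have h2 : y ^ 2 / (2 * (1 - y)) ≤ y ^ 2 / (2 * (1 - u)) := by gcongr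
    have h3 : y ^ 2 / 2 + y ^ 3 * 4 / 18 ≤ y ^ 2 / (2 * (1 - y)) := by
      rw [le_div_iff₀ (by linarith)]
      nlinarith [pow_pos h 3, pow_pos h 4]
    linarith

/-- **Ville's inequality** for nonnegative supermartingales. -/
theorem MeasureTheory.Supermartingale.measure_exists_le_le {Ω : Type*} {m0 : MeasurableSpace Ω}
    {μ : Measure Ω} [IsFiniteMeasure μ] {ℱ : Filtration ℕ m0} {M : ℕ → Ω → ℝ}
    (hM : Supermartingale M ℱ μ) (hnonneg : ∀ k ω, 0 ≤ M k ω) {a : ℝ} (ha : 0 < a) :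
    μ {ω | ∃ k, a ≤ M k ω} ≤ ENNReal.ofReal ((∫ ω, M 0 ω ∂μ) / a) := by
  set T : ℕ → Set Ω := fun k => {ω | ∀ j ≤ k, M j ω < a} with hT
  have hTsucc : ∀ k, T (k + 1) = T k ∩ {ω | M (k + 1) ω < a} := by
    intro k
    ext ω
    simp only [hT, Set.mem_ofPred_eq, Set.mem_inter_iff, Nat.le_succ_iff_eq_or_le]
    aesop
  have hmeasM : ∀ k, MeasurableSet[ℱ k] {ω | M k ω < a} := fun k =>
    (hM.stronglyMeasurable k).measurable measurableSet_Iio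
  have hTmeas : ∀ k, MeasurableSet[ℱ k] (T k) := by
    intro k
    induction k with
    | zero => simpa [hT] using hmeasM 0
    | succ k ih =>
      rw [hTsucc]
      exact (ℱ.mono k.le_succ _ ih).inter (hmeasM _)
  have hTmeas' : ∀ k, MeasurableSet (T k) := fun k => ℱ.le k _ (hTmeas k)
  have hmeasM' : ∀ k, MeasurableSet {ω | M k ω < a} := fun k => ℱ.le k _ (hmeasM k)
  have key : ∀ k, a * μ.real (T k)ᶜ + ∫ ω in T k, M k ω ∂μ ≤ ∫ ω, M 0 ω ∂μ := by
    have markov : ∀ (k : ℕ) (s : Set Ω), MeasurableSet s → (∀ ω ∈ s, a ≤ M k ω) →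
        a * μ.real s ≤ ∫ ω in s, M k ω ∂μ := by
      intro k s hs h
      have := setIntegral_mono_on (integrable_const a).integrableOn
        (hM.integrable k).integrableOn hs h
      simpa [mul_comm] using this
    intro k
    induction k with
    | zero =>
      have h1 := markov 0 (T 0)ᶜ (hTmeas' 0).compl (by intro ω; simp [hT])
      have h2 := integral_add_compl (hTmeas' 0) (hM.integrable 0)
      linarith
    | succ k ih =>
      have h1 := hM.setIntegral_le k.le_succ (hTmeas k)
      set D := T k \ {ω | M (k + 1) ω < a} with hD
      have hDm : MeasurableSet D := (hTmeas' k).diff (hmeasM' _)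
      have h2 := markov (k + 1) D hDm (by intro ω hω; simpa using hω.2)
      have h3 := integral_inter_add_sdiff (s := T k) (hmeasM' (k + 1))
        (hM.integrable (k + 1)).integrableOn
      have h4 : μ.real (T (k + 1))ᶜ = μ.real (T k)ᶜ + μ.real D := by
        rw [← measureReal_union _ hDm]
        · congr 1
          rw [hTsucc, hD]
          ext ω
          simp
          tauto
        · exact Set.disjoint_left.2 fun ω h h' => h h'.1
      rw [h4, hTsucc]
      rw [← hD] at h3
      linarith
  have hunion : {ω | ∃ k, a ≤ M k ω} = ⋃ k, (T k)ᶜ := by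
    ext ω
    simp only [hT, Set.mem_ofPred_eq, Set.mem_iUnion, Set.mem_compl_iff]
    push Not
    exact ⟨fun ⟨k, h⟩ => ⟨k, k, le_rfl, h⟩, fun ⟨_, j, _, h⟩ => ⟨j, h⟩⟩
  have hmono : Monotone fun k => (T k)ᶜ := fun i j hij =>
    Set.compl_subset_compl.2 fun ω h l hl => h l (hl.trans hij)
  rw [hunion, hmono.measure_iUnion]
  refine iSup_le fun k => ?_
  rw [ENNReal.le_ofReal_iff_toReal_le (measure_ne_top _ _)
    (div_nonneg (integral_nonneg (hnonneg 0)) ha.le), le_div_iff₀ ha]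
  have h := key k
  have h' : 0 ≤ ∫ ω in T k, M k ω ∂μ := integral_nonneg (hnonneg k)
  change μ.real (T k)ᶜ * a ≤ _
  linarith

section Freedman

variable {Ω : Type*} {m0 : MeasurableSpace Ω} {μ : Measure Ω} [IsProbabilityMeasure μ]
  {ℱ : Filtration ℕ m0} {ξ : ℕ → Ω → ℝ} {B : ℝ}

/-- Freedman's exponential supermartingale. -/
theorem supermartingale_exp_sub_quadratic
    (hmeas : ∀ i, 1 ≤ i → StronglyMeasurable[ℱ i] (ξ i))
    (hint : ∀ i, 1 ≤ i → Integrable (ξ i) μ)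
    (hsq : ∀ i, 1 ≤ i → Integrable (fun ω => ξ i ω ^ 2) μ)
    (hmds : ∀ i, 1 ≤ i → μ[ξ i | ℱ (i - 1)] =ᵐ[μ] 0)
    (hB : 0 < B) (hbdd : ∀ i, 1 ≤ i → ∀ᵐ ω ∂μ, ξ i ω ≤ B)
    {l : ℝ} (hl : 0 ≤ l) (hlB : l * B < 1) :
    Supermartingale (fun k ω => Real.exp (l * ∑ i ∈ Icc 1 k, ξ i ω -
      l ^ 2 / (2 * (1 - l * B)) * ∑ i ∈ Icc 1 k, (μ[fun ω' => ξ i ω' ^ 2 | ℱ (i - 1)]) ω))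
      ℱ μ := by
  set C := l ^ 2 / (2 * (1 - l * B)) with hC
  have hC0 : 0 ≤ C := div_nonneg (sq_nonneg l) (by linarith)
  set q : ℕ → Ω → ℝ := fun i => μ[fun ω' => ξ i ω' ^ 2 | ℱ (i - 1)] with hq
  change Supermartingale (fun k ω => Real.exp (l * ∑ i ∈ Icc 1 k, ξ i ω -
      C * ∑ i ∈ Icc 1 k, q i ω)) ℱ μ
  have hqm : ∀ i, StronglyMeasurable[ℱ (i - 1)] (q i) := fun i => stronglyMeasurable_condExp
  have hq0 : ∀ᵐ ω ∂μ, ∀ i, 0 ≤ q i ω := ae_all_iff.2 fun i =>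
    condExp_nonneg (Filter.Eventually.of_forall fun ω => sq_nonneg _)
  have hbdd' : ∀ᵐ ω ∂μ, ∀ i, 1 ≤ i → ξ i ω ≤ B := by
    simpa only [ae_all_iff] using hbdd
  have hS : ∀ k, StronglyMeasurable[ℱ k] (fun ω => ∑ i ∈ Icc 1 k, ξ i ω) := fun k =>
    Finset.stronglyMeasurable_fun_sum _ fun i hi =>
      (hmeas i (mem_Icc.1 hi).1).mono (ℱ.mono (mem_Icc.1 hi).2)
  have hV : ∀ k j, k ≤ j + 1 → StronglyMeasurable[ℱ j] (fun ω => ∑ i ∈ Icc 1 k, q i ω) :=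
    fun k j hkj => Finset.stronglyMeasurable_fun_sum _ fun i hi =>
      (hqm i).mono (ℱ.mono (by have := (mem_Icc.1 hi).2; omega))
  have hM : ∀ k, StronglyMeasurable[ℱ k] (fun ω => Real.exp (l * ∑ i ∈ Icc 1 k, ξ i ω -
      C * ∑ i ∈ Icc 1 k, q i ω)) := fun k =>
    Real.continuous_exp.comp_stronglyMeasurable
      (((hS k).const_mul l).sub ((hV k k k.le_succ).const_mul C))
  have hbound : ∀ k, ∀ᵐ ω ∂μ, ∀ j,
      Real.exp (l * ∑ i ∈ Icc 1 k, ξ i ω - C * ∑ i ∈ Icc 1 j, q i ω) ≤ Real.exp (l * (k * B)) := by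
    intro k
    filter_upwards [hq0, hbdd'] with ω h0 h1 j
    have hs : ∑ i ∈ Icc 1 k, ξ i ω ≤ k * B := by
      have := Finset.sum_le_card_nsmul (Icc 1 k) (fun i => ξ i ω) B
        fun i hi => h1 i (mem_Icc.1 hi).1
      simpa using this
    have hv : 0 ≤ ∑ i ∈ Icc 1 j, q i ω := Finset.sum_nonneg fun i _ => h0 i
    have := mul_le_mul_of_nonneg_left hs hl
    have := mul_nonneg hC0 hv
    exact Real.exp_le_exp.2 (by linarith)
  have hMint : ∀ k, Integrable (fun ω => Real.exp (l * ∑ i ∈ Icc 1 k, ξ i ω -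
      C * ∑ i ∈ Icc 1 k, q i ω)) μ := fun k =>
    Integrable.of_bound ((hM k).mono (ℱ.le k)).aestronglyMeasurable (Real.exp (l * (k * B))) <| by
      filter_upwards [hbound k] with ω h
      rw [Real.norm_of_nonneg (Real.exp_pos _).le]
      exact h k
  refine supermartingale_nat hM hMint fun k => ?_
  have hk : 1 ≤ k + 1 := by omega
  set W : Ω → ℝ := fun ω => Real.exp (l * ∑ i ∈ Icc 1 k, ξ i ω -
      C * ∑ i ∈ Icc 1 (k + 1), q i ω) with hW
  have hWm : StronglyMeasurable[ℱ k] W := Real.continuous_exp.comp_stronglyMeasurable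
      (((hS k).const_mul l).sub ((hV (k + 1) k le_rfl).const_mul C))
  have hWb : ∀ᵐ ω ∂μ, ‖W ω‖ ≤ Real.exp (l * (k * B)) := by
    filter_upwards [hbound k] with ω h
    rw [Real.norm_of_nonneg (Real.exp_pos _).le]
    exact h (k + 1)
  set R : Ω → ℝ := (fun _ => (1 : ℝ)) + (l • ξ (k + 1) + C • fun ω => ξ (k + 1) ω ^ 2) with hR
  have hi1 : Integrable (l • ξ (k + 1)) μ := (hint _ hk).smul l
  have hi2 : Integrable (C • fun ω => ξ (k + 1) ω ^ 2) μ := (hsq _ hk).smul C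
  have hRint : Integrable R μ := (integrable_const _).add (hi1.add hi2)
  have hRcond : μ[R | ℱ k] =ᵐ[μ] fun ω => 1 + C * q (k + 1) ω := by
    have e1 := condExp_add (integrable_const (1 : ℝ)) (hi1.add hi2) (ℱ k)
    have e2 := condExp_add hi1 hi2 (ℱ k)
    have e3 := condExp_smul (μ := μ) l (ξ (k + 1)) (ℱ k)
    have e4 := condExp_smul (μ := μ) C (fun ω => ξ (k + 1) ω ^ 2) (ℱ k)
    have e5 := hmds (k + 1) hk
    rw [Nat.add_sub_cancel] at e5
    filter_upwards [e1, e2, e3, e4, e5] with ω h1 h2 h3 h4 h5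
    rw [hR, h1, Pi.add_apply, h2, Pi.add_apply, h3, h4, condExp_const (ℱ.le k)]
    simp [h5, hq]
  have hWR := condExp_stronglyMeasurable_mul_of_bound₀ (ℱ.le k)
    hWm.aestronglyMeasurable hRint _ hWb
  have hWRint : Integrable (W * R) μ :=
    hRint.bdd_mul (hWm.mono (ℱ.le k)).aestronglyMeasurable hWb
  have hle : (fun ω => Real.exp (l * ∑ i ∈ Icc 1 (k + 1), ξ i ω -
      C * ∑ i ∈ Icc 1 (k + 1), q i ω)) ≤ᵐ[μ] W * R := by
    filter_upwards [hbdd'] with ω h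
    have h1 := Real.exp_le_one_add_add_sq_div (mul_nonneg hl hB.le) hlB
      (mul_le_mul_of_nonneg_left (h (k + 1) hk) hl)
    have h2 : Real.exp (l * ξ (k + 1) ω) ≤ R ω := by
      refine h1.trans (le_of_eq ?_)
      simp [hR, hC]
      ring
    rw [Finset.sum_Icc_succ_top hk (fun i => ξ i ω), Pi.mul_apply, mul_add,
      show ∀ a b c : ℝ, a + b - c = (a - c) + b by intros; ring, Real.exp_add]
    exact mul_le_mul_of_nonneg_left h2 (Real.exp_pos _).le
  filter_upwards [condExp_mono (m := ℱ k) (hMint (k + 1)) hWRint hle, hWR, hRcond]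
    with ω h1 h2 h3
  refine h1.trans ?_
  rw [h2, Pi.mul_apply, h3, hW]
  have h4 : 1 + C * q (k + 1) ω ≤ Real.exp (C * q (k + 1) ω) := by
    rw [add_comm]; exact Real.add_one_le_exp _
  refine (mul_le_mul_of_nonneg_left h4 (Real.exp_pos _).le).trans (le_of_eq ?_)
  rw [← Real.exp_add, Finset.sum_Icc_succ_top hk (fun i => q i ω)]
  ring_nf

/-- **Freedman's inequality**, uniform in time, for martingale differences bounded above. -/
theorem freedman_exists_le
    (hmeas : ∀ i, 1 ≤ i → StronglyMeasurable[ℱ i] (ξ i))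
    (hint : ∀ i, 1 ≤ i → Integrable (ξ i) μ)
    (hsq : ∀ i, 1 ≤ i → Integrable (fun ω => ξ i ω ^ 2) μ)
    (hmds : ∀ i, 1 ≤ i → μ[ξ i | ℱ (i - 1)] =ᵐ[μ] 0)
    (hB : 0 < B) (hbdd : ∀ i, 1 ≤ i → ∀ᵐ ω ∂μ, ξ i ω ≤ B)
    {v e : ℝ} (hv : 0 < v) (he : 0 < e) :
    μ {ω | ∃ k, Real.sqrt (2 * v * e) + B * e ≤ ∑ i ∈ Icc 1 k, ξ i ω ∧
      ∑ i ∈ Icc 1 k, (μ[fun ω' => ξ i ω' ^ 2 | ℱ (i - 1)]) ω ≤ v} ≤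
      ENNReal.ofReal (Real.exp (-e)) := by
  set s := Real.sqrt (2 * v * e) / v with hs
  have hs0 : 0 < s := by positivity
  have hsv : Real.sqrt (2 * v * e) = s * v := by rw [hs]; field_simp
  have hss : s ^ 2 * v = 2 * e := by
    rw [hs, div_pow, Real.sq_sqrt (by positivity)]; field_simp
  have hd : 0 < 1 + B * s := by positivity
  set l := s / (1 + B * s) with hl
  have hl0 : 0 < l := by positivity
  have hlB : 1 - l * B = 1 / (1 + B * s) := by rw [hl]; field_simp; ring
  have hlB1 : l * B < 1 := by
    have : 0 < 1 - l * B := by rw [hlB]; positivity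
    linarith
  have hM := supermartingale_exp_sub_quadratic hmeas hint hsq hmds hB hbdd hl0.le hlB1
  have hville := hM.measure_exists_le_le (fun k ω => (Real.exp_pos _).le) (Real.exp_pos e)
  refine (measure_mono ?_).trans (hville.trans (le_of_eq ?_))
  · rintro ω ⟨k, h1, h2⟩
    refine ⟨k, Real.exp_le_exp.2 ?_⟩
    have hC0 : 0 ≤ l ^ 2 / (2 * (1 - l * B)) := div_nonneg (sq_nonneg l) (by linarith)
    have h3 := mul_le_mul_of_nonneg_left h1 hl0.le
    have h4 := mul_le_mul_of_nonneg_left h2 hC0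
    have h5 : l * (Real.sqrt (2 * v * e) + B * e) - l ^ 2 / (2 * (1 - l * B)) * v = e := by
      rw [hlB, hsv, hl]
      field_simp
      linear_combination hss
    linarith
  · simp [Real.exp_neg]

end Freedman

/-- Combining deviation bounds over the dyadic scales `B ^ 2 * 2 ^ j` of the variance `V`. -/
theorem le_of_forall_dyadic {S V B L : ℝ} (hV : 0 ≤ V) (hB : 0 < B) (hL : 1 ≤ L)
    (h : ∀ j : ℕ, V ≤ B ^ 2 * 2 ^ j →
      S < Real.sqrt (2 * (B ^ 2 * 2 ^ j) * (L + 2 * Real.log j)) + B * (L + 2 * Real.log j)) :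
    S ≤ 2 * Real.sqrt (V * (L + 2 * Real.log (1 + max 0 (Real.logb 2 (V / B ^ 2)))))
      + 4 * B * (L + 2 * Real.log (1 + max 0 (Real.logb 2 (V / B ^ 2)))) := by
  have hB2 : 0 < B ^ 2 := by positivity
  rcases le_or_gt V (B ^ 2) with hVB | hVB
  · have hlog : Real.logb 2 (V / B ^ 2) ≤ 0 :=
      Real.logb_nonpos (by norm_num) (by positivity) ((div_le_one hB2).2 hVB)
    have h0 := h 0 (by simpa using hVB)
    have h1 : Real.sqrt (2 * B ^ 2 * L) ≤ 2 * B * L :=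
      Real.sqrt_le_iff.2 ⟨by positivity, by nlinarith [mul_pos hB2 (by linarith : 0 < L)]⟩
    have h2 := Real.sqrt_nonneg (V * L)
    simp only [pow_zero, mul_one, CharP.cast_eq_zero, Real.log_zero, mul_zero, add_zero] at h0
    rw [max_eq_left hlog]
    simp only [add_zero, Real.log_one, mul_zero]
    nlinarith [mul_pos hB (by linarith : 0 < L)]
  · have hr : 1 < V / B ^ 2 := (one_lt_div hB2).2 hVB
    set x := Real.logb 2 (V / B ^ 2) with hx
    have hx0 : 0 < x := Real.logb_pos (by norm_num) hr
    have hpow : (2 : ℝ) ^ x = V / B ^ 2 :=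
      Real.rpow_logb (by norm_num) (by norm_num) (by linarith)
    set j := ⌈x⌉₊ with hj
    have hxj : x ≤ j := Nat.le_ceil x
    have hjx : (j : ℝ) < x + 1 := Nat.ceil_lt_add_one hx0.le
    have hj1 : (0 : ℝ) < j := by linarith
    have hlow : V ≤ B ^ 2 * 2 ^ j := by
      rw [← div_le_iff₀' hB2, ← hpow, ← Real.rpow_natCast]
      exact Real.rpow_le_rpow_of_exponent_le (by norm_num) hxj
    have hup : B ^ 2 * 2 ^ j ≤ 2 * V := by
      have : (2 : ℝ) ^ j ≤ 2 * (V / B ^ 2) := by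
        rw [← hpow, ← Real.rpow_natCast, mul_comm, ← Real.rpow_add_one (by norm_num)]
        exact Real.rpow_le_rpow_of_exponent_le (by norm_num) hjx.le
      calc B ^ 2 * 2 ^ j ≤ B ^ 2 * (2 * (V / B ^ 2)) := by gcongr
        _ = 2 * V := by field_simp
    rw [max_eq_right hx0.le]
    have hlogj : Real.log j ≤ Real.log (1 + x) := Real.log_le_log hj1 (by linarith)
    have hlogj0 : 0 ≤ Real.log j := Real.log_natCast_nonneg j
    set e := L + 2 * Real.log (1 + x) with he
    have hle : L + 2 * Real.log j ≤ e := by linarith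
    have h1 : Real.sqrt (2 * (B ^ 2 * 2 ^ j) * (L + 2 * Real.log j)) ≤ 2 * Real.sqrt (V * e) := by
      calc _ ≤ Real.sqrt (2 ^ 2 * (V * e)) := by
            apply Real.sqrt_le_sqrt
            calc _ ≤ 2 * (2 * V) * e := by gcongr
              _ = _ := by ring
        _ = _ := by rw [Real.sqrt_mul (by norm_num), Real.sqrt_sq (by norm_num)]
    have h2 := h j hlow
    have h3 := mul_le_mul_of_nonneg_left hle hB.le
    nlinarith [mul_pos hB (by linarith : 0 < e)]

theorem tsum_ofReal_exp_neg_log_le {δ : ℝ} (hδ : 0 < δ) :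
    ∑' j : ℕ, ENNReal.ofReal (Real.exp (-(Real.log (1 / δ) + 2 * Real.log j))) ≤
      ENNReal.ofReal (3 * δ) := by
  have hterm : ∀ j : ℕ, Real.exp (-(Real.log (1 / δ) + 2 * Real.log j)) =
      δ * ((if j = 0 then 1 else 0) + 1 / (j : ℝ) ^ 2) := by
    intro j
    rw [neg_add, Real.exp_add, one_div, Real.log_inv, neg_neg, Real.exp_log hδ]
    rcases Nat.eq_zero_or_pos j with rfl | hj
    · simp
    · have hj' : (0 : ℝ) < j := by exact_mod_cast hj
      rw [if_neg hj.ne', ← Real.log_rpow hj', Real.exp_neg, Real.exp_log (by positivity)]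
      norm_num
  have hsum : HasSum (fun j : ℕ => δ * ((if j = 0 then 1 else 0) + 1 / (j : ℝ) ^ 2))
      (δ * (1 + Real.pi ^ 2 / 6)) :=
    ((hasSum_ite_eq 0 1).add hasSum_zeta_two).mul_left δ
  simp_rw [hterm]
  rw [← ENNReal.ofReal_tsum_of_nonneg (fun j => by positivity) hsum.summable, hsum.tsum_eq]
  apply ENNReal.ofReal_le_ofReal
  have hpi : Real.pi ^ 2 ≤ 12 := by nlinarith [Real.pi_lt_d2, Real.pi_pos]
  nlinarith

end Auxiliary


open MeasureTheory Finset in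
/-- Corollary of Freedman's inequality: a uniform-in-time self-normalized bound,
with probability at least `1 − 3δ`. -/
theorem stmt_11 {Ω : Type*} {m0 : MeasurableSpace Ω} (μ : Measure Ω) [IsProbabilityMeasure μ]
    (ℱ : Filtration ℕ m0) (ξ : ℕ → Ω → ℝ)
    (hmeas : ∀ i, 1 ≤ i → StronglyMeasurable[ℱ i] (ξ i))
    (hint : ∀ i, 1 ≤ i → Integrable (ξ i) μ)
    (hsq : ∀ i, 1 ≤ i → Integrable (fun ω => ξ i ω ^ 2) μ)
    (hmds : ∀ i, 1 ≤ i → μ[ξ i | ℱ (i - 1)] =ᵐ[μ] 0)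
    (B : ℝ) (hB : 0 < B)
    (hbdd : ∀ i, 1 ≤ i → ∀ᵐ ω ∂μ, ξ i ω ≤ B)
    (δ : ℝ) (hδ : δ ∈ Set.Ioo (0:ℝ) (1/3)) :
    ENNReal.ofReal (1 - 3 * δ) ≤
      μ {ω | ∀ k, 1 ≤ k →
        ∑ i ∈ Finset.Icc 1 k, ξ i ω ≤
          2 * Real.sqrt ((∑ i ∈ Finset.Icc 1 k, (μ[fun ω' => ξ i ω' ^ 2 | ℱ (i - 1)]) ω) *
              (Real.log (1/δ) + 2 * Real.log (1 + max 0
                (Real.logb 2 ((∑ i ∈ Finset.Icc 1 k, (μ[fun ω' => ξ i ω' ^ 2 | ℱ (i - 1)]) ω)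
                  / B^2)))))
            + 4 * B * (Real.log (1/δ) + 2 * Real.log (1 + max 0
                (Real.logb 2 ((∑ i ∈ Finset.Icc 1 k, (μ[fun ω' => ξ i ω' ^ 2 | ℱ (i - 1)]) ω)
                  / B^2))))} := by
  obtain ⟨hδ0, hδ3⟩ := hδ
  set L := Real.log (1 / δ) with hLdef
  have hL : 1 ≤ L := by
    rw [hLdef, Real.le_log_iff_exp_le (by positivity), le_div_iff₀ hδ0]
    nlinarith [Real.exp_one_lt_three, Real.exp_pos 1]
  set good := {ω | ∀ k, 1 ≤ k →
        ∑ i ∈ Finset.Icc 1 k, ξ i ω ≤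
          2 * Real.sqrt ((∑ i ∈ Finset.Icc 1 k, (μ[fun ω' => ξ i ω' ^ 2 | ℱ (i - 1)]) ω) *
              (L + 2 * Real.log (1 + max 0
                (Real.logb 2 ((∑ i ∈ Finset.Icc 1 k, (μ[fun ω' => ξ i ω' ^ 2 | ℱ (i - 1)]) ω)
                  / B^2)))))
            + 4 * B * (L + 2 * Real.log (1 + max 0
                (Real.logb 2 ((∑ i ∈ Finset.Icc 1 k, (μ[fun ω' => ξ i ω' ^ 2 | ℱ (i - 1)]) ω)
                  / B^2))))} with hgood
  set bad : ℕ → Set Ω := fun j => {ω | ∃ k,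
    Real.sqrt (2 * (B ^ 2 * 2 ^ j) * (L + 2 * Real.log j)) + B * (L + 2 * Real.log j) ≤
      ∑ i ∈ Icc 1 k, ξ i ω ∧
      ∑ i ∈ Icc 1 k, (μ[fun ω' => ξ i ω' ^ 2 | ℱ (i - 1)]) ω ≤ B ^ 2 * 2 ^ j} with hbad
  have hq0 : ∀ᵐ ω ∂μ, ∀ i, 0 ≤ (μ[fun ω' => ξ i ω' ^ 2 | ℱ (i - 1)]) ω := ae_all_iff.2 fun i =>
    condExp_nonneg (Filter.Eventually.of_forall fun ω => sq_nonneg _)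
  have hcover : (goodᶜ : Set Ω) ≤ᵐ[μ] ⋃ j, bad j := by
    filter_upwards [hq0] with ω hω hng
    by_contra hnb
    refine hng fun k _ => le_of_forall_dyadic (Finset.sum_nonneg fun i _ => hω i) hB hL
      fun j hj => ?_
    by_contra! hlt
    exact hnb (Set.mem_iUnion.2 ⟨j, k, hlt, hj⟩)
  have hgoodc : μ goodᶜ ≤ ENNReal.ofReal (3 * δ) := by
    refine (measure_mono_ae hcover).trans ((measure_iUnion_le _).trans
      (le_trans (ENNReal.tsum_le_tsum fun j => ?_) (tsum_ofReal_exp_neg_log_le hδ0)))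
    exact freedman_exists_le hmeas hint hsq hmds hB hbdd (by positivity)
      (by linarith [Real.log_natCast_nonneg j])
  rw [ENNReal.ofReal_sub _ (by positivity), ENNReal.ofReal_one, tsub_le_iff_right,
    ← measure_univ (μ := μ), ← Set.union_compl_self good]
  exact (measure_union_le _ _).trans (by gcongr)
end

section
/- Let (Ω, ℱ, P) be a probability space with a filtration (ℱ_i)_{i ≥ 0}, and let (ξ_i)_{i ≥ 1} be a square-integrable martingale difference sequence adapted to (ℱ_i) (each ξ_i is ℱ_i-measurable with E[ξ_i | ℱ_{i−1}] = 0). Define S_n := Σ_{i=1}^{n} ξ_i and ⟨S⟩_n := Σ_{i=1}^{n} E[ξ_i² | ℱ_{i−1}]. Suppose ξ_i ≤ b almost surely for all i ≥ 1, where b > 0 is a constant, and let (ν_t)_{t ≥ 1} be a sequence of nonnegative random variables with ν_t ℱ_t-measurable such that for every k ≥ 1, ⟨S⟩_k ≤ Σ_{i=1}^{k} ν_i almost surely. Then for all c > 0 and δ ∈ (0, 1/3), with probability at least 1 − 3δ it holds that for every k ≥ 1: S_k − (c/b)·Σ_{i=1}^{k} ν_i ≤ (8/c + 4)·(log(1/δ)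 + 2·log₂⁺((32 + 16c)/c²))·b. -/
theorem Real.exp_le_one_add_add_sq {y : ℝ} (hy : y ≤ 1) : Real.exp y ≤ 1 + y + y ^ 2 := by
  rcases le_total (-1) y with h | h
  · have := (abs_le.mp (Real.abs_exp_sub_one_sub_id_le (abs_le.mpr ⟨h, hy⟩))).2
    linarith
  · have := Real.exp_le_one_iff.mpr (show y ≤ 0 by linarith)
    nlinarith

namespace MeasureTheory

variable {Ω : Type*} {m0 : MeasurableSpace Ω}

/-- The partial products `∏ i < n, Y i`, frozen from the first time they reach level `a`. -/
noncomputable def frozenProd (Y : ℕ → Ω → ℝ) (a : ℝ) : ℕ → Ω → ℝ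
  | 0 => fun _ => 1
  | n + 1 => {ω | a ≤ frozenProd Y a n ω}.indicator (frozenProd Y a n) +
      {ω | a ≤ frozenProd Y a n ω}ᶜ.indicator (frozenProd Y a n) * Y n

theorem frozenProd_succ_of_le {Y : ℕ → Ω → ℝ} {a : ℝ} {n : ℕ} {ω : Ω}
    (h : a ≤ frozenProd Y a n ω) : frozenProd Y a (n + 1) ω = frozenProd Y a n ω := by
  simp [frozenProd, h]

theorem frozenProd_succ_of_lt {Y : ℕ → Ω → ℝ} {a : ℝ} {n : ℕ} {ω : Ω}
    (h : frozenProd Y a n ω < a) :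
    frozenProd Y a (n + 1) ω = frozenProd Y a n ω * Y n ω := by
  simp [frozenProd, h]

theorem frozenProd_nonneg {Y : ℕ → Ω → ℝ} (hY : ∀ n ω, 0 ≤ Y n ω) (a : ℝ) (n : ℕ) (ω : Ω) :
    0 ≤ frozenProd Y a n ω := by
  induction n with
  | zero => simp [frozenProd]
  | succ n ih =>
    rcases le_or_gt a (frozenProd Y a n ω) with h | h
    · rwa [frozenProd_succ_of_le h]
    · rw [frozenProd_succ_of_lt h]
      exact mul_nonneg ih (hY n ω)

theorem le_frozenProd_of_le {Y : ℕ → Ω → ℝ} {a : ℝ} {m n : ℕ} (hmn : m ≤ n) {ω : Ω}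
    (h : a ≤ frozenProd Y a m ω) : a ≤ frozenProd Y a n ω := by
  induction n, hmn using Nat.le_induction with
  | base => exact h
  | succ n _ ih => rwa [frozenProd_succ_of_le ih]

theorem frozenProd_eq_prod_or_le (Y : ℕ → Ω → ℝ) (a : ℝ) (n : ℕ) (ω : Ω) :
    frozenProd Y a n ω = ∏ i ∈ Finset.range n, Y i ω ∨ a ≤ frozenProd Y a n ω := by
  induction n with
  | zero => simp [frozenProd]
  | succ n ih =>
    rcases le_or_gt a (frozenProd Y a n ω) with h | h
    · exact .inr (le_frozenProd_of_le n.le_succ h)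
    · left
      rw [frozenProd_succ_of_lt h, Finset.prod_range_succ, ih.resolve_right h.not_ge]

theorem frozenProd_le {Y : ℕ → Ω → ℝ} {a C : ℝ} {ω : Ω} (ha : 0 ≤ a) (hY : ∀ n, 0 ≤ Y n ω)
    (hYC : ∀ n, Y n ω ≤ C) (n : ℕ) : frozenProd Y a n ω ≤ max 1 (a * C) := by
  induction n with
  | zero => simp [frozenProd]
  | succ n ih =>
    rcases le_or_gt a (frozenProd Y a n ω) with h | h
    · rwa [frozenProd_succ_of_le h]
    · rw [frozenProd_succ_of_lt h]
      exact (mul_le_mul h.le (hYC n) (hY n) ha).trans (le_max_right _ _)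

theorem stronglyMeasurable_frozenProd {ℱ : Filtration ℕ m0} {Y : ℕ → Ω → ℝ}
    (hY : ∀ n, StronglyMeasurable[ℱ (n + 1)] (Y n)) (a : ℝ) (n : ℕ) :
    StronglyMeasurable[ℱ n] (frozenProd Y a n) := by
  induction n with
  | zero => exact stronglyMeasurable_const
  | succ n ih =>
    have hN := ih.mono (ℱ.mono n.le_succ)
    have hA : MeasurableSet[ℱ (n + 1)] {ω | a ≤ frozenProd Y a n ω} :=
      StronglyMeasurable.measurableSet_le stronglyMeasurable_const hN
    exact (hN.indicator hA).add ((hN.indicator hA.compl).mul (hY n))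

/-- Ville's maximal inequality for the partial products of nonnegative bounded variables whose
conditional expectations are at most one. -/
theorem measure_exists_le_prod_le (μ : Measure Ω) [IsProbabilityMeasure μ]
    {ℱ : Filtration ℕ m0} {Y : ℕ → Ω → ℝ}
    (hYmeas : ∀ n, StronglyMeasurable[ℱ (n + 1)] (Y n)) (hY : ∀ n ω, 0 ≤ Y n ω) {C : ℝ}
    (hYC : ∀ n, ∀ᵐ ω ∂μ, Y n ω ≤ C) (hYcond : ∀ n, μ[Y n | ℱ n] ≤ᵐ[μ] 1) {a : ℝ} (ha : 0 < a) :
    μ {ω | ∃ n, a ≤ ∏ i ∈ Finset.range n, Y i ω} ≤ ENNReal.ofReal (1 / a) := by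
  have hmeas n : StronglyMeasurable (frozenProd Y a n) :=
    (stronglyMeasurable_frozenProd hYmeas a n).mono (ℱ.le n)
  have hYint n : Integrable (Y n) μ :=
    .of_bound ((hYmeas n).mono (ℱ.le _)).aestronglyMeasurable C (by
      filter_upwards [hYC n] with ω h
      rwa [Real.norm_of_nonneg (hY n ω)])
  have hbound : ∀ᵐ ω ∂μ, ∀ n, ‖frozenProd Y a n ω‖ ≤ max 1 (a * C) := by
    filter_upwards [ae_all_iff.mpr hYC] with ω h n
    rw [Real.norm_of_nonneg (frozenProd_nonneg hY a n ω)]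
    exact frozenProd_le ha.le (fun n => hY n ω) h n
  have hint n : Integrable (frozenProd Y a n) μ :=
    .of_bound (hmeas n).aestronglyMeasurable _ (hbound.mono fun ω h => h n)
  have hexp n : ∫ ω, frozenProd Y a n ω ∂μ ≤ 1 := by
    induction n with
    | zero => simp [frozenProd]
    | succ n ih =>
      refine le_trans ?_ ih
      set N := frozenProd Y a n with hN
      set A := {ω | a ≤ N ω}
      have hAF : MeasurableSet[ℱ n] A := StronglyMeasurable.measurableSet_le
        stronglyMeasurable_const (stronglyMeasurable_frozenProd hYmeas a n)
      have hA : MeasurableSet A := ℱ.le n _ hAF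
      have hZF : StronglyMeasurable[ℱ n] (Aᶜ.indicator N) :=
        (stronglyMeasurable_frozenProd hYmeas a n).indicator hAF.compl
      have hZ0 ω : 0 ≤ Aᶜ.indicator N ω :=
        Set.indicator_nonneg (fun ω _ => frozenProd_nonneg hY a n ω) ω
      have hZb : ∀ᵐ ω ∂μ, ‖Aᶜ.indicator N ω‖ ≤ max 1 (a * C) :=
        hbound.mono fun ω h => (norm_indicator_le_norm_self _ _).trans (h n)
      have hZint : Integrable (Aᶜ.indicator N) μ := (hint n).indicator hA.compl
      have hZY : Integrable (Aᶜ.indicator N * Y n) μ :=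
        (hYint n).bdd_mul (hZF.mono (ℱ.le n)).aestronglyMeasurable hZb
      have hpull := condExp_stronglyMeasurable_mul_of_bound (ℱ.le n) hZF (hYint n) _ hZb
      have hle : ∫ ω, (Aᶜ.indicator N * Y n) ω ∂μ ≤ ∫ ω, Aᶜ.indicator N ω ∂μ := by
        rw [← integral_condExp (ℱ.le n)]
        refine integral_mono_ae integrable_condExp hZint ?_
        filter_upwards [hpull, hYcond n] with ω h1 h2
        rw [h1, Pi.mul_apply]
        exact mul_le_of_le_one_right (hZ0 ω) h2
      calc ∫ ω, frozenProd Y a (n + 1) ω ∂μ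
          = ∫ ω, A.indicator N ω ∂μ + ∫ ω, (Aᶜ.indicator N * Y n) ω ∂μ :=
            integral_add ((hint n).indicator hA) hZY
        _ ≤ ∫ ω, A.indicator N ω ∂μ + ∫ ω, Aᶜ.indicator N ω ∂μ := by gcongr
        _ = ∫ ω, N ω ∂μ := by
            rw [integral_indicator hA, integral_indicator hA.compl, integral_add_compl hA (hint n)]
  have hmono : Monotone fun n => {ω | a ≤ frozenProd Y a n ω} :=
    fun m n hmn ω h => le_frozenProd_of_le hmn h
  have hsub : {ω | ∃ n, a ≤ ∏ i ∈ Finset.range n, Y i ω} ⊆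
      ⋃ n, {ω | a ≤ frozenProd Y a n ω} := by
    rintro ω ⟨n, hn⟩
    refine Set.mem_iUnion.mpr ⟨n, ?_⟩
    rcases frozenProd_eq_prod_or_le Y a n ω with h | h
    · exact hn.trans_eq h.symm
    · exact h
  refine (measure_mono hsub).trans ?_
  rw [hmono.measure_iUnion]
  refine iSup_le fun n => ?_
  rw [← ofReal_measureReal]
  refine ENNReal.ofReal_le_ofReal ?_
  rw [le_div_iff₀' ha]
  exact (mul_meas_ge_le_integral_of_nonneg
    (ae_of_all _ (frozenProd_nonneg hY a n)) (hint n) a).trans (hexp n)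

/-- The compensated exponential of a square-integrable, conditionally centered variable `X` with
`t * X ≤ 1` has conditional expectation at most one. -/
theorem condExp_exp_sub_sq_le_one (μ : Measure Ω) [IsProbabilityMeasure μ]
    {m : MeasurableSpace Ω} (hm : m ≤ m0) {X : Ω → ℝ} (hX : Integrable X μ)
    (hsq : Integrable (fun ω => X ω ^ 2) μ) (hcond : μ[X | m] =ᵐ[μ] 0) {t : ℝ}
    (hXt : ∀ᵐ ω ∂μ, t * X ω ≤ 1) :
    μ[fun ω => Real.exp (t * X ω - t ^ 2 * (μ[fun ω' => X ω' ^ 2 | m]) ω) | m] ≤ᵐ[μ] 1 := by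
  set V := μ[fun ω' => X ω' ^ 2 | m]
  have hV : StronglyMeasurable[m] V := stronglyMeasurable_condExp
  have hV0 : 0 ≤ᵐ[μ] V := condExp_nonneg (ae_of_all _ fun ω => sq_nonneg _)
  set Z : Ω → ℝ := fun ω => Real.exp (-(t ^ 2 * V ω))
  have hZ : StronglyMeasurable[m] Z :=
    Real.continuous_exp.comp_stronglyMeasurable (hV.const_mul _).neg
  have hZb : ∀ᵐ ω ∂μ, ‖Z ω‖ ≤ 1 := by
    filter_upwards [hV0] with ω h
    rw [Real.norm_of_nonneg (Real.exp_pos _).le, Real.exp_le_one_iff, neg_nonpos]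
    exact mul_nonneg (sq_nonneg t) h
  set Q : Ω → ℝ := (fun _ => 1) + (t • X + t ^ 2 • fun ω => X ω ^ 2)
  have hlin : Integrable (t • X + t ^ 2 • fun ω => X ω ^ 2) μ := (hX.smul t).add (hsq.smul (t ^ 2))
  have hQ : Integrable Q μ := (integrable_const 1).add hlin
  have hZQ : Integrable (Z * Q) μ := hQ.bdd_mul (hZ.mono hm).aestronglyMeasurable hZb
  have hle : ∀ᵐ ω ∂μ, Real.exp (t * X ω - t ^ 2 * V ω) ≤ (Z * Q) ω := by
    filter_upwards [hXt] with ω h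
    have h1 := Real.exp_le_one_add_add_sq h
    have h2 : Q ω = 1 + t * X ω + (t * X ω) ^ 2 := by
      simp only [Q, Pi.add_apply, Pi.smul_apply, smul_eq_mul]
      ring
    rw [sub_eq_neg_add, Real.exp_add, Pi.mul_apply, h2]
    exact mul_le_mul_of_nonneg_left h1 (Real.exp_pos _).le
  have hint : Integrable (fun ω => Real.exp (t * X ω - t ^ 2 * V ω)) μ := by
    refine hZQ.mono' ?_ ?_
    · exact Real.continuous_exp.comp_aestronglyMeasurable
        ((hX.1.const_mul t).sub ((hV.mono hm).aestronglyMeasurable.const_mul _))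
    · filter_upwards [hle] with ω h
      rwa [Real.norm_of_nonneg (Real.exp_pos _).le]
  filter_upwards [condExp_mono (m := m) hint hZQ hle,
    condExp_stronglyMeasurable_mul_of_bound hm hZ hQ 1 hZb,
    condExp_add (integrable_const (1 : ℝ)) hlin m,
    condExp_add (hX.smul t) (hsq.smul (t ^ 2)) m,
    condExp_smul (μ := μ) t X m, condExp_smul (μ := μ) (t ^ 2) (fun ω => X ω ^ 2) m,
    hcond] with ω h1 h2 h3 h4 h5 h6 h7
  refine h1.trans ?_
  have h8 : (μ[Q | m]) ω = 1 + t ^ 2 * V ω := by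
    rw [h3, Pi.add_apply, h4, Pi.add_apply, h5, h6, condExp_const hm]
    simp [h7, V]
  rw [h2, Pi.mul_apply, h8, Pi.one_apply]
  calc Z ω * (1 + t ^ 2 * V ω) ≤ Z ω * Real.exp (t ^ 2 * V ω) := by
        refine mul_le_mul_of_nonneg_left ?_ (Real.exp_pos _).le
        linarith [Real.add_one_le_exp (t ^ 2 * V ω)]
    _ = 1 := by rw [← Real.exp_add]; simp

/-- A time-uniform Freedman inequality with a single exponential tilt `t`. -/
theorem measure_exists_sum_sub_gt_le (μ : Measure Ω) [IsProbabilityMeasure μ]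
    (ℱ : Filtration ℕ m0) {X : ℕ → Ω → ℝ} (hmeas : ∀ n, StronglyMeasurable[ℱ (n + 1)] (X n))
    (hint : ∀ n, Integrable (X n) μ) (hsq : ∀ n, Integrable (fun ω => X n ω ^ 2) μ)
    (hcond : ∀ n, μ[X n | ℱ n] =ᵐ[μ] 0) {t : ℝ} (ht : 0 < t)
    (hXt : ∀ n, ∀ᵐ ω ∂μ, t * X n ω ≤ 1) {δ : ℝ} (hδ : 0 < δ) :
    μ {ω | ∃ n, Real.log (1 / δ) / t + t * ∑ i ∈ Finset.range n, (μ[fun ω' => X i ω' ^ 2 | ℱ i]) ω <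
      ∑ i ∈ Finset.range n, X i ω} ≤ ENNReal.ofReal δ := by
  set V : ℕ → Ω → ℝ := fun n => μ[fun ω' => X n ω' ^ 2 | ℱ n]
  have hV0 n : 0 ≤ᵐ[μ] V n := condExp_nonneg (ae_of_all _ fun ω => sq_nonneg _)
  have key := measure_exists_le_prod_le μ (ℱ := ℱ)
    (Y := fun n ω => Real.exp (t * X n ω - t ^ 2 * V n ω)) (C := Real.exp 1)
    (fun n => Real.continuous_exp.comp_stronglyMeasurable (((hmeas n).const_mul t).sub
      ((stronglyMeasurable_condExp.mono (ℱ.mono n.le_succ)).const_mul _)))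
    (fun n ω => (Real.exp_pos _).le)
    (fun n => by
      filter_upwards [hXt n, hV0 n] with ω h1 h2
      have := mul_nonneg (sq_nonneg t) h2
      exact Real.exp_le_exp.mpr (by linarith))
    (fun n => condExp_exp_sub_sq_le_one μ (ℱ.le n) (hint n) (hsq n) (hcond n) (hXt n))
    (one_div_pos.mpr hδ)
  rw [one_div_one_div] at key
  refine (measure_mono ?_).trans key
  rintro ω ⟨n, hn⟩
  refine ⟨n, ?_⟩
  change 1 / δ ≤ ∏ i ∈ Finset.range n, Real.exp (t * X i ω - t ^ 2 * V i ω)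
  rw [← Real.exp_sum, ← Real.log_le_iff_le_exp (one_div_pos.mpr hδ), Finset.sum_sub_distrib,
    ← Finset.mul_sum, ← Finset.mul_sum]
  have h := mul_lt_mul_of_pos_left hn ht
  rw [mul_add, mul_div_cancel₀ _ ht.ne'] at h
  change _ + t * (t * ∑ i ∈ Finset.range n, V i ω) < _ at h
  nlinarith

end MeasureTheory

open MeasureTheory Finset in
/-- Second corollary of Freedman's inequality: with probability at least `1 − 3δ`,
uniformly in `k`, `S_k − (c/b) Σ ν_i` is bounded by a constant. -/
theorem stmt_12 {Ω : Type*} {m0 : MeasurableSpace Ω} (μ : Measure Ω) [IsProbabilityMeasure μ]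
    (ℱ : Filtration ℕ m0) (ξ : ℕ → Ω → ℝ)
    (hmeas : ∀ i, 1 ≤ i → StronglyMeasurable[ℱ i] (ξ i))
    (hint : ∀ i, 1 ≤ i → Integrable (ξ i) μ)
    (hsq : ∀ i, 1 ≤ i → Integrable (fun ω => ξ i ω ^ 2) μ)
    (hmds : ∀ i, 1 ≤ i → μ[ξ i | ℱ (i - 1)] =ᵐ[μ] 0)
    (b : ℝ) (hb : 0 < b)
    (hbdd : ∀ i, 1 ≤ i → ∀ᵐ ω ∂μ, ξ i ω ≤ b)
    (ν : ℕ → Ω → ℝ)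
    (hνnonneg : ∀ t, 1 ≤ t → ∀ᵐ ω ∂μ, 0 ≤ ν t ω)
    (hνmeas : ∀ t, 1 ≤ t → StronglyMeasurable[ℱ t] (ν t))
    (hνdom : ∀ k, 1 ≤ k → ∀ᵐ ω ∂μ,
      (∑ i ∈ Finset.Icc 1 k, (μ[fun ω' => ξ i ω' ^ 2 | ℱ (i - 1)]) ω) ≤
        ∑ i ∈ Finset.Icc 1 k, ν i ω)
    (c δ : ℝ) (hc : 0 < c) (hδ : δ ∈ Set.Ioo (0:ℝ) (1/3)) :
    ENNReal.ofReal (1 - 3 * δ) ≤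
      μ {ω | ∀ k, 1 ≤ k →
        (∑ i ∈ Finset.Icc 1 k, ξ i ω) - (c/b) * ∑ i ∈ Finset.Icc 1 k, ν i ω ≤
          (8/c + 4) * (Real.log (1/δ) +
            2 * max 0 (Real.logb 2 ((32 + 16*c)/c^2))) * b} := by
  obtain ⟨hδ0, hδ1⟩ := hδ
  set t : ℝ := c / (8 + 4 * c) / b with ht_def
  have hden : 0 < 8 + 4 * c := by positivity
  have ht : 0 < t := by positivity
  have htb : t * b = c / (8 + 4 * c) := div_mul_cancel₀ _ hb.ne'
  have htb1 : t * b ≤ 1 := by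
    rw [htb, div_le_one hden]
    linarith
  have htc : t ≤ c / b := by
    rw [ht_def]
    gcongr
    exact div_le_self hc.le (by linarith)
  have htinv : (8 / c + 4) * b = 1 / t := by
    rw [ht_def]
    field_simp
  have key := measure_exists_sum_sub_gt_le μ ℱ (X := fun n => ξ (n + 1))
    (fun n => hmeas _ n.succ_pos) (fun n => hint _ n.succ_pos) (fun n => hsq _ n.succ_pos)
    (fun n => hmds _ n.succ_pos) ht
    (fun n => (hbdd _ n.succ_pos).mono fun ω h =>
      (mul_le_mul_of_nonneg_left h ht.le).trans htb1) hδ0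
  have hdom : ∀ᵐ ω ∂μ, ∀ k, 1 ≤ k →
      (∑ i ∈ Icc 1 k, (μ[fun ω' => ξ i ω' ^ 2 | ℱ (i - 1)]) ω) ≤ ∑ i ∈ Icc 1 k, ν i ω :=
    ae_all_iff.mpr fun k => Filter.eventually_imp_distrib_left.mpr (hνdom k)
  have hV0 : ∀ᵐ ω ∂μ, ∀ i, 0 ≤ (μ[fun ω' => ξ i ω' ^ 2 | ℱ (i - 1)]) ω :=
    ae_all_iff.mpr fun i => condExp_nonneg (ae_of_all _ fun ω => sq_nonneg _)
  set B := {ω | ∃ n, Real.log (1 / δ) / t +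
    t * ∑ i ∈ range n, (μ[fun ω' => ξ (i + 1) ω' ^ 2 | ℱ i]) ω < ∑ i ∈ range n, ξ (i + 1) ω}
  have hB : ENNReal.ofReal (1 - 3 * δ) ≤ μ Bᶜ := by
    have h1 : 1 ≤ μ B + μ Bᶜ := by
      rw [← measure_univ (μ := μ), ← Set.union_compl_self B]
      exact measure_union_le _ _
    calc ENNReal.ofReal (1 - 3 * δ) ≤ ENNReal.ofReal (1 - δ) :=
          ENNReal.ofReal_le_ofReal (by linarith)
      _ = 1 - ENNReal.ofReal δ := by rw [ENNReal.ofReal_sub _ hδ0.le, ENNReal.ofReal_one]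
      _ ≤ μ Bᶜ := tsub_le_iff_left.mpr (h1.trans (by gcongr))
  refine hB.trans (measure_mono_ae ?_)
  filter_upwards [hdom, hV0] with ω h1 h2 h3 k hk
  have h4 := not_lt.mp (not_exists.mp h3 k)
  have h5 (f : ℕ → ℝ) : ∑ i ∈ Icc 1 k, f i = ∑ i ∈ range k, f (i + 1) := by
    rw [range_eq_Ico, sum_Ico_add' f 0 k 1]
    rfl
  have h6 := h1 k hk
  have h7 : 0 ≤ ∑ i ∈ Icc 1 k, (μ[fun ω' => ξ i ω' ^ 2 | ℱ (i - 1)]) ω :=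
    sum_nonneg fun i _ => h2 i
  have h8 := h5 fun i => (μ[fun ω' => ξ i ω' ^ 2 | ℱ (i - 1)]) ω
  simp only [Nat.add_sub_cancel] at h8
  rw [← h8, ← h5 fun i => ξ i ω] at h4
  have h9 := mul_le_mul htc h6 h7 (by positivity)
  have h10 : (8 / c + 4) * (Real.log (1 / δ) +
      2 * max 0 (Real.logb 2 ((32 + 16 * c) / c ^ 2))) * b =
      Real.log (1 / δ) / t + 1 / t * (2 * max 0 (Real.logb 2 ((32 + 16 * c) / c ^ 2))) := by
    rw [mul_right_comm, htinv]
    ring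
  have h11 : 0 ≤ 1 / t * (2 * max 0 (Real.logb 2 ((32 + 16 * c) / c ^ 2))) := by positivity
  rw [h10]
  linarith
end
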